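/- Let H₀ be an n×n Hermitian positive definite complex matrix and let H₁ be an n×n Hermitian negative semidefinite complex matrix (i.e. ⟨H₁u, u⟩ ≤ 0 for all u). If λ ∈ ℂ and there exists a nonzero u ∈ ℂⁿ with H₀ u + λ H₁ u + λ² u = 0, then Re λ ≥ 0 and λ ≠ 0. -/

import Mathlib

open scoped ComplexOrder

/-- A root of `a - b z + c z²` with `a, c > 0` and `b ≥ 0` lies in the closed right half-plane
and is nonzero. -/
lemma Complex.re_nonneg_and_ne_zero_of_quadratic_root {a b c z : ℂ}
    (ha : 0 < a) (hb : 0 ≤ b) (hc : 0 < c) (h : a - z * b + z ^ 2 * c = 0) :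
    0 ≤ z.re ∧ z ≠ 0 := by
  refine ⟨?_, by rintro rfl; simp [ha.ne'] at h⟩
  obtain ⟨ha, ha'⟩ := Complex.pos_iff.mp ha
  obtain ⟨hb, hb'⟩ := Complex.nonneg_iff.mp hb
  obtain ⟨hc, hc'⟩ := Complex.pos_iff.mp hc
  have hre := congrArg Complex.re h
  have him := congrArg Complex.im h
  simp only [pow_two, Complex.add_re, Complex.sub_re, Complex.mul_re, Complex.mul_im,
    Complex.add_im, Complex.sub_im, Complex.zero_re, Complex.zero_im, ← ha', ← hb',
    ← hc'] at hre him
  by_contra! hx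
  have hfactor : z.im * (2 * z.re * c.re - b.re) = 0 := by linear_combination him
  rcases mul_eq_zero.mp hfactor with hy | hy
  · rw [hy] at hre
    nlinarith [mul_nonneg hb (neg_nonneg.mpr hx.le), mul_nonneg (sq_nonneg z.re) hc.le]
  · nlinarith [mul_pos (neg_pos.mpr hx) hc]

/-- If `H₀` is Hermitian positive definite and `H₁` is Hermitian negative semidefinite
(i.e. `-H₁` is positive semidefinite), then any eigenvalue `lam` of the quadratic pencil
`H₀ + lam H₁ + lam² I` satisfies `Re lam ≥ 0` and `lam ≠ 0`. -/
theorem pencil_posDef_negSemidef_spectrum_right_halfplane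
    (n : ℕ) (hn : 1 ≤ n) (H₀ H₁ : Matrix (Fin n) (Fin n) ℂ)
    (hH₀ : H₀.PosDef) (hH₁ : (-H₁).PosSemidef) (lam : ℂ)
    (h : ∃ u : Fin n → ℂ, u ≠ 0 ∧
        H₀.mulVec u + lam • H₁.mulVec u + lam ^ 2 • u = 0) :
    0 ≤ lam.re ∧ lam ≠ 0 := by
  obtain ⟨u, hu, h⟩ := h
  refine Complex.re_nonneg_and_ne_zero_of_quadratic_root (hH₀.dotProduct_mulVec_pos hu)
    (hH₁.dotProduct_mulVec_nonneg u) (Matrix.dotProduct_star_self_pos_iff.mpr hu) ?_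
  have hdot := congrArg (star u ⬝ᵥ ·) h
  simp only [dotProduct_add, dotProduct_smul, dotProduct_zero, smul_eq_mul] at hdot
  rw [Matrix.neg_mulVec, dotProduct_neg]
  linear_combination hdot
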